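/- Every primitive triple of integers (x, y, z) satisfying x³ + 9y³ = 431² · z⁹ satisfies x ≡ y ≡ 0 (mod 431). -/

import Mathlib

namespace PureCubicThree

section NumberField

open Polynomial Module NumberField

theorem isEisensteinAt_X_pow_three_sub_three :
    (X ^ 3 - C 3 : ℤ[X]).IsEisensteinAt (Submodule.span ℤ {3}) := by
  refine Monic.isEisensteinAt_of_mem_of_notMem (monic_X_pow_sub_C 3 three_ne_zero) ?_ ?_ ?_
  · intro h
    have : (1 : ℤ) ∈ Submodule.span ℤ {(3 : ℤ)} := h ▸ Submodule.mem_top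
    norm_num [Ideal.mem_span_singleton] at this
  · intro n hn
    rw [natDegree_X_pow_sub_C] at hn
    rw [Ideal.submodule_span_eq, Ideal.mem_span_singleton]
    interval_cases n <;> simp [coeff_X_pow, coeff_ofNat_zero]
  · rw [Ideal.submodule_span_eq, Ideal.span_singleton_pow, Ideal.mem_span_singleton]
    norm_num [coeff_X_pow]

theorem irreducible_X_pow_three_sub_three : Irreducible (X ^ 3 - C 3 : ℚ[X]) := by
  have hm : (X ^ 3 - C 3 : ℤ[X]).Monic := monic_X_pow_sub_C 3 three_ne_zero
  have h := isEisensteinAt_X_pow_three_sub_three.irreducible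
    ((Ideal.span_singleton_prime three_ne_zero).2 Int.prime_three) hm.isPrimitive
    (by rw [natDegree_X_pow_sub_C]; norm_num)
  simpa [map_ofNat] using (hm.irreducible_iff_irreducible_map_fraction_map (K := ℚ)).1 h

theorem isIntegral_of_pow_three_eq {K : Type*} [Field K] {θ : K} (hθ : θ ^ 3 = 3) :
    IsIntegral ℤ θ :=
  ⟨X ^ 3 - C 3, monic_X_pow_sub_C 3 three_ne_zero, by simp [hθ]⟩

theorem coe_pow_three_eq {K : Type*} [Field K] {ϑ : 𝓞 K} (hϑ : ϑ ^ 3 = 3) :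
    (ϑ : K) ^ 3 = 3 := by
  rw [← map_pow, hϑ, map_ofNat]

variable {K : Type*} [Field K] [NumberField K] {θ : K}

theorem minpoly_rat (hθ : θ ^ 3 = 3) : minpoly ℚ θ = X ^ 3 - C 3 :=
  (minpoly.eq_of_irreducible_of_monic irreducible_X_pow_three_sub_three (by simp [hθ])
    (monic_X_pow_sub_C 3 three_ne_zero)).symm

theorem minpoly_int (hθ : θ ^ 3 = 3) : minpoly ℤ θ = X ^ 3 - C 3 := by
  apply map_injective (algebraMap ℤ ℚ) (RingHom.injective_int _)
  rw [← minpoly.isIntegrallyClosed_eq_field_fractions' ℚ (isIntegral_of_pow_three_eq hθ),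
    minpoly_rat hθ]
  simp [map_ofNat]

/-- The power basis `1, θ, θ²` of a cubic field generated by a cube root of `3`. -/
noncomputable def powerBasis (hK : finrank ℚ K = 3) (hθ : θ ^ 3 = 3) : PowerBasis ℚ K :=
  PowerBasis.ofAdjoinEqTop (isIntegral_of_pow_three_eq hθ).tower_top (by
    have h := (Field.primitive_element_iff_minpoly_natDegree_eq ℚ θ).2
      (by rw [minpoly_rat hθ, natDegree_X_pow_sub_C, hK])
    rw [← IntermediateField.adjoin_simple_toSubalgebra_of_isAlgebraic
      (Algebra.IsAlgebraic.isAlgebraic θ), h, IntermediateField.top_toSubalgebra])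

theorem powerBasis_gen (hK : finrank ℚ K = 3) (hθ : θ ^ 3 = 3) :
    (powerBasis hK hθ).gen = θ := rfl

theorem powerBasis_dim (hK : finrank ℚ K = 3) (hθ : θ ^ 3 = 3) :
    (powerBasis hK hθ).dim = 3 := by
  rw [← PowerBasis.finrank, hK]

theorem norm_eq (hK : finrank ℚ K = 3) (hθ : θ ^ 3 = 3) : Algebra.norm ℚ θ = 3 := by
  have h := Algebra.PowerBasis.norm_gen_eq_coeff_zero_minpoly (powerBasis hK hθ)
  rw [powerBasis_dim, powerBasis_gen, minpoly_rat hθ] at h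
  rw [h]
  norm_num [coeff_X_pow]

theorem discr_powerBasis (hK : finrank ℚ K = 3) (hθ : θ ^ 3 = 3) :
    Algebra.discr ℚ (powerBasis hK hθ).basis = -243 := by
  rw [Algebra.discr_powerBasis_eq_norm, powerBasis_gen, minpoly_rat hθ, hK]
  have : aeval θ (derivative (X ^ 3 - C 3 : ℚ[X])) = algebraMap ℚ K 3 * θ ^ 2 := by
    simp
    norm_num
  rw [this, map_mul, Algebra.norm_algebraMap, map_pow, norm_eq hK hθ, hK]
  norm_num

theorem mem_adjoin_of_isIntegral (hK : finrank ℚ K = 3) (hθ : θ ^ 3 = 3) {z : K}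
    (hz : IsIntegral ℤ z) : z ∈ Algebra.adjoin ℤ ({θ} : Set K) := by
  have hint := isIntegral_of_pow_three_eq hθ
  have h := Algebra.discr_mul_isIntegral_mem_adjoin (R := ℤ) ℚ (B := powerBasis hK hθ) hint hz
  rw [discr_powerBasis, powerBasis_gen] at h
  refine mem_adjoin_of_smul_prime_pow_smul_of_minpoly_isEisensteinAt (R := ℤ) (K := ℚ)
    (B := powerBasis hK hθ) (p := 3) (n := 5) Int.prime_three hint hz ?_ ?_
  · rw [powerBasis_gen]
    convert neg_mem h using 1
    simp [Algebra.smul_def]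
  · rw [powerBasis_gen, minpoly_int hθ]
    exact isEisensteinAt_X_pow_three_sub_three

variable {ϑ : 𝓞 K}

theorem adjoin_eq_top (hK : finrank ℚ K = 3) (hϑ : ϑ ^ 3 = 3) :
    Algebra.adjoin ℤ ({ϑ} : Set (𝓞 K)) = ⊤ := by
  have hθ := coe_pow_three_eq hϑ
  refine eq_top_iff.2 fun z _ => ?_
  have hz := mem_adjoin_of_isIntegral hK hθ z.isIntegral_coe
  have himage := AlgHom.map_adjoin_singleton ((Algebra.ofId (𝓞 K) K).restrictScalars ℤ) ϑ
  have hz' : (z : K) ∈ (Algebra.adjoin ℤ ({ϑ} : Set (𝓞 K))).map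
      ((Algebra.ofId (𝓞 K) K).restrictScalars ℤ) := by
    rw [himage]
    exact hz
  obtain ⟨y, hy, hyz⟩ := hz'
  rwa [← RingOfIntegers.coe_injective hyz]

theorem exists_basis (hK : finrank ℚ K = 3) (hϑ : ϑ ^ 3 = 3) :
    ∃ b : Basis (Fin 3) ℤ (𝓞 K), ∀ i, b i = ϑ ^ (i : ℕ) := by
  have hθ := coe_pow_three_eq hϑ
  let pb := PowerBasis.ofAdjoinEqTop' (RingOfIntegers.isIntegral ϑ) (adjoin_eq_top hK hϑ)
  have hdim : pb.dim = 3 := by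
    rw [PowerBasis.ofAdjoinEqTop'_dim, ← RingOfIntegers.minpoly_coe, minpoly_int hθ,
      natDegree_X_pow_sub_C]
  refine ⟨pb.basis.reindex (finCongr hdim), fun i => ?_⟩
  rw [Basis.reindex_apply, PowerBasis.basis_eq_pow, PowerBasis.ofAdjoinEqTop'_gen]
  rfl

theorem exists_coords (hK : finrank ℚ K = 3) (hϑ : ϑ ^ 3 = 3) (z : 𝓞 K) :
    ∃ a b c : ℤ, z = a + b * ϑ + c * ϑ ^ 2 := by
  obtain ⟨b, hb⟩ := exists_basis hK hϑ
  refine ⟨b.repr z 0, b.repr z 1, b.repr z 2, ?_⟩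
  conv_lhs => rw [← b.sum_repr z]
  simp [Fin.sum_univ_three, hb]

theorem coords_eq_zero (hK : finrank ℚ K = 3) (hϑ : ϑ ^ 3 = 3) {a b c : ℤ}
    (h : (a : 𝓞 K) + b * ϑ + c * ϑ ^ 2 = 0) : a = 0 ∧ b = 0 ∧ c = 0 := by
  obtain ⟨e, he⟩ := exists_basis hK hϑ
  have h' := Fintype.linearIndependent_iff.1 e.linearIndependent ![a, b, c]
    (by simpa [Fin.sum_univ_three, he] using h)
  exact ⟨h' 0, h' 1, h' 2⟩

theorem discr_eq (hK : finrank ℚ K = 3) (hϑ : ϑ ^ 3 = 3) : discr K = -243 := by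
  have hθ := coe_pow_three_eq hϑ
  obtain ⟨b, hb⟩ := exists_basis hK hϑ
  have hdiscr := Algebra.discr_localizationLocalization ℤ (nonZeroDivisors ℤ) K b (Rₘ := ℚ)
  have hbasis : (b.localizationLocalization ℚ (nonZeroDivisors ℤ) K : Fin 3 → K) =
      (powerBasis hK hθ).basis ∘ (finCongr (powerBasis_dim hK hθ)).symm := by
    ext i
    simp [hb, powerBasis_gen]
  rw [hbasis, Algebra.discr_reindex, discr_powerBasis, discr_eq_discr K b] at hdiscr
  rw [eq_intCast] at hdiscr
  exact_mod_cast hdiscr.symm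

theorem nrComplexPlaces_eq_one (hK : finrank ℚ K = 3) (hϑ : ϑ ^ 3 = 3) :
    InfinitePlace.nrComplexPlaces K = 1 := by
  have hrank := InfinitePlace.card_add_two_mul_card_eq_rank K
  have hsign := sign_discr K
  rw [discr_eq hK hϑ] at hsign
  have : InfinitePlace.nrComplexPlaces K ≤ 1 := by omega
  interval_cases h : InfinitePlace.nrComplexPlaces K
  · exact absurd hsign (by decide)
  · rfl

theorem units_rank_eq_one (hK : finrank ℚ K = 3) (hϑ : ϑ ^ 3 = 3) : Units.rank K = 1 := by
  have hrank := InfinitePlace.card_add_two_mul_card_eq_rank K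
  have hcard := InfinitePlace.card_eq_nrRealPlaces_add_nrComplexPlaces K
  rw [nrComplexPlaces_eq_one hK hϑ] at hrank hcard
  rw [Units.rank]
  omega

theorem isPrincipal_of_mem_of_forall {R : Type*} [CommRing R] {P : Ideal R} (hP : P ≠ ⊤) {π : R}
    (hπ : π ∈ P) (h : ∀ z : R, π ∣ z ∨ ∃ w, π ∣ z * w - 1) : P.IsPrincipal := by
  refine ⟨π, le_antisymm (fun z hz => ?_) ((Ideal.span_singleton_le_iff_mem P).2 hπ)⟩
  rw [Ideal.submodule_span_eq, Ideal.mem_span_singleton]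
  refine (h z).resolve_right ?_
  rintro ⟨w, hw⟩
  refine hP ((Ideal.eq_top_iff_one P).2 ?_)
  have := P.sub_mem (P.mul_mem_right w hz) (P.mem_of_dvd hw hπ)
  simpa using this

theorem isPrincipalIdealRing (hK : finrank ℚ K = 3) (hϑ : ϑ ^ 3 = 3) :
    IsPrincipalIdealRing (𝓞 K) := by
  refine RingOfIntegers.isPrincipalIdealRing_of_isPrincipal_of_norm_le_of_isPrime ?_
  rintro ⟨P, hP0⟩ hP hle
  simp only at hP hle ⊢
  rw [nrComplexPlaces_eq_one hK hϑ, discr_eq hK hϑ, hK] at hle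
  have hlt : Ideal.absNorm P < 5 := by
    have hs : √|((-243 : ℤ) : ℝ)| < 16 := by
      rw [Real.sqrt_lt' (by norm_num)]
      norm_num
    have hpi : 4 / Real.pi < 4 / 3 := by
      gcongr
      exact Real.pi_gt_three
    have : (Ideal.absNorm P : ℝ) < 5 := by
      refine hle.trans_lt ?_
      have h0 : 0 ≤ √|((-243 : ℤ) : ℝ)| := Real.sqrt_nonneg _
      simp only [pow_one, Nat.factorial]
      push_cast at *
      nlinarith [mul_lt_mul'' hpi hs (by positivity) h0]
    exact_mod_cast this
  have hmem := Ideal.absNorm_mem P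
  have hpos : Ideal.absNorm P ≠ 0 := Ideal.absNorm_ne_zero_of_nonZeroDivisors ⟨P, hP0⟩
  have htop : P ≠ ⊤ := hP.ne_top
  have h2or3 : (2 : 𝓞 K) ∈ P ∨ (3 : 𝓞 K) ∈ P := by
    interval_cases h : Ideal.absNorm P
    · exact absurd rfl hpos
    · exact absurd (Ideal.absNorm_eq_one_iff.1 h) htop
    · exact Or.inl (by simpa using hmem)
    · exact Or.inr (by simpa using hmem)
    · refine Or.inl (hP.mem_of_pow_mem 2 ?_)
      norm_num
      simpa using hmem
  rcases h2or3 with h2 | h3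
  · have hfac : (ϑ - 1) * (ϑ ^ 2 + ϑ + 1) ∈ P := by
      convert h2 using 1
      linear_combination hϑ
    rcases hP.mem_or_mem hfac with h | h
    · refine isPrincipal_of_mem_of_forall htop h fun z => ?_
      obtain ⟨a, b, c, rfl⟩ := exists_coords hK hϑ z
      obtain ⟨k, hk | hk⟩ := Int.even_or_odd' (a + b + c)
      · refine Or.inl ⟨k * (ϑ ^ 2 + ϑ + 1) + b + c * (ϑ + 1), ?_⟩
        have hk' : (a : 𝓞 K) + b + c = 2 * k := by exact_mod_cast hk
        linear_combination hk' - k * hϑ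
      · refine Or.inr ⟨1, k * (ϑ ^ 2 + ϑ + 1) + b + c * (ϑ + 1), ?_⟩
        have hk' : (a : 𝓞 K) + b + c = 2 * k + 1 := by exact_mod_cast hk
        linear_combination hk' - k * hϑ
    · refine isPrincipal_of_mem_of_forall htop h fun z => ?_
      obtain ⟨a, b, c, rfl⟩ := exists_coords hK hϑ z
      have key : ∀ k l : ℤ, ϑ ^ 2 + ϑ + 1 ∣ 2 * (k + l * ϑ) := fun k l ↦
        ⟨(k + l * ϑ) * (ϑ - 1), by linear_combination (-(k : 𝓞 K) - l * ϑ) * hϑ⟩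
      obtain ⟨k, hk⟩ := Int.even_or_odd' (a - c)
      obtain ⟨l, hl⟩ := Int.even_or_odd' (b - c)
      obtain ⟨m, hm⟩ := key k l
      rcases hk with hk | hk <;> rcases hl with hl | hl <;>
        replace hk := congrArg (Int.cast : ℤ → 𝓞 K) hk <;>
        replace hl := congrArg (Int.cast : ℤ → 𝓞 K) hl <;> push_cast at hk hl
      · exact Or.inl ⟨m + c, by linear_combination hm + hk + ϑ * hl⟩
      · exact Or.inr ⟨-1 - ϑ, m * (-1 - ϑ) + c * (-1 - ϑ) - 1, by
          linear_combination (-1 - ϑ) * (hm + hk + ϑ * hl)⟩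
      · exact Or.inr ⟨1, m + c, by linear_combination hm + hk + ϑ * hl⟩
      · exact Or.inr ⟨-ϑ, m * (-ϑ) + c * (-ϑ) - 1, by
          linear_combination (-ϑ) * (hm + hk + ϑ * hl)⟩
  · have hmem : ϑ ∈ P := hP.mem_of_pow_mem 3 (hϑ ▸ h3)
    refine isPrincipal_of_mem_of_forall htop hmem fun z => ?_
    obtain ⟨a, b, c, rfl⟩ := exists_coords hK hϑ z
    have h3dvd : ∀ k : ℤ, ϑ ∣ 3 * k := fun k => ⟨ϑ ^ 2 * k, by linear_combination (-(k : 𝓞 K)) * hϑ⟩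
    obtain ⟨m, hm⟩ := h3dvd (a / 3)
    have ha := congrArg (Int.cast : ℤ → 𝓞 K) (Int.mul_ediv_add_emod a 3)
    push_cast at ha
    have : a % 3 = 0 ∨ a % 3 = 1 ∨ a % 3 = 2 := by omega
    rcases this with h | h | h <;> rw [h] at ha <;> push_cast at ha
    · exact Or.inl ⟨m + b + c * ϑ, by linear_combination hm - ha⟩
    · exact Or.inr ⟨1, m + b + c * ϑ, by linear_combination hm - ha⟩
    · exact Or.inr ⟨-1, -(m + b + c * ϑ) - ϑ ^ 2, by linear_combination -hm + ha + hϑ⟩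

theorem exists_numberField : ∃ (K : Type) (_ : Field K) (_ : NumberField K) (ϑ : 𝓞 K),
    finrank ℚ K = 3 ∧ ϑ ^ 3 = 3 := by
  have : Fact (Irreducible (X ^ 3 - C 3 : ℚ[X])) := ⟨irreducible_X_pow_three_sub_three⟩
  have hne : (X ^ 3 - C 3 : ℚ[X]) ≠ 0 := irreducible_X_pow_three_sub_three.ne_zero
  have hfin : FiniteDimensional ℚ (AdjoinRoot (X ^ 3 - C 3 : ℚ[X])) :=
    (AdjoinRoot.powerBasis hne).finite
  have hroot : AdjoinRoot.root (X ^ 3 - C 3 : ℚ[X]) ^ 3 = 3 := by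
    have := AdjoinRoot.eval₂_root (X ^ 3 - C 3 : ℚ[X])
    simpa [sub_eq_zero] using this
  refine ⟨AdjoinRoot (X ^ 3 - C 3 : ℚ[X]), inferInstance,
    { to_charZero := charZero_of_injective_algebraMap (algebraMap ℚ _).injective
      to_finiteDimensional := hfin },
    ⟨AdjoinRoot.root _, isIntegral_of_pow_three_eq hroot⟩, ?_, ?_⟩
  · rw [(AdjoinRoot.powerBasis hne).finrank, AdjoinRoot.powerBasis_dim]
    compute_degree!
  · ext
    exact hroot

end NumberField

section UnitCubes

open NumberField

theorem exists_unit_eq_pow_mul_cube {K : Type*} [Field K] [NumberField K]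
    (hodd : Odd (Module.finrank ℚ K)) (hrank : Units.rank K = 1) {ε : (𝓞 K)ˣ}
    (hε : ∀ v : (𝓞 K)ˣ, ε ≠ v ^ 3) (u : (𝓞 K)ˣ) : ∃ i < 3, ∃ v : (𝓞 K)ˣ, u = ε ^ i * v ^ 3 := by
  obtain ⟨g, hg⟩ : ∃ g : (𝓞 K)ˣ, ∀ u : (𝓞 K)ˣ, ∃ (s : (𝓞 K)ˣ) (e : ℤ), u = s ^ 3 * g ^ e := by
    refine ⟨Units.fundSystem K ⟨0, by omega⟩, fun u => ?_⟩
    obtain ⟨⟨ζ, f⟩, hu, -⟩ := Units.exist_unique_eq_mul_prod K u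
    refine ⟨ζ, f ⟨0, by omega⟩, ?_⟩
    have hprod : ∏ i, Units.fundSystem K i ^ f i =
        Units.fundSystem K ⟨0, by omega⟩ ^ f ⟨0, by omega⟩ :=
      Fintype.prod_eq_single _ fun i hi => absurd (Fin.ext (by omega)) hi
    have hζ : (ζ : (𝓞 K)ˣ) ^ 3 = ζ := by
      rcases Units.torsion_eq_one_or_neg_one_of_odd_finrank hodd ζ with h | h <;> rw [h]
      · simp
      · simp [Odd.neg_one_pow (by decide : Odd 3)]
    rw [hζ, ← hprod]
    exact hu
  obtain ⟨s, j, hs⟩ := hg ε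
  obtain ⟨t, e, ht⟩ := hg u
  have hj : j % 3 ≠ 0 := fun h => hε (s * g ^ (j / 3)) (by
    rw [hs, mul_pow, ← zpow_natCast (g ^ (j / 3)), ← zpow_mul]
    congr
    push_cast
    omega)
  obtain ⟨i, hi, m, hm⟩ : ∃ i : ℕ, i < 3 ∧ ∃ m : ℤ, e = j * i + m * 3 := by
    have hj' : j % 3 = 1 ∨ j % 3 = 2 := by omega
    have he : e % 3 = 0 ∨ e % 3 = 1 ∨ e % 3 = 2 := by omega
    rcases he with he | he | he
    · exact ⟨0, by norm_num, e / 3, by push_cast; omega⟩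
    · rcases hj' with hj' | hj'
      · exact ⟨1, by norm_num, (e - j) / 3, by push_cast; omega⟩
      · exact ⟨2, by norm_num, (e - j * 2) / 3, by push_cast; omega⟩
    · rcases hj' with hj' | hj'
      · exact ⟨2, by norm_num, (e - j * 2) / 3, by push_cast; omega⟩
      · exact ⟨1, by norm_num, (e - j) / 3, by push_cast; omega⟩
  refine ⟨i, hi, t * (s ^ i)⁻¹ * g ^ m, ?_⟩
  have hpow : u = t ^ 3 * ((g ^ j) ^ i * (g ^ m) ^ 3) := by
    rw [ht, hm, zpow_add, zpow_mul, zpow_mul, zpow_natCast]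
    rfl
  rw [hpow, hs, mul_pow, mul_pow, mul_pow, inv_pow, pow_right_comm s 3 i]
  have hcomm (a b c d : (𝓞 K)ˣ) : a * b * (d * a⁻¹ * c) = (a * a⁻¹) * (d * (b * c)) := by ac_rfl
  rw [hcomm, mul_inv_cancel, one_mul]

end UnitCubes

section FieldOfOrder

variable {F : Type*} [Field F] {ω : F}

theorem frobenius_apply (hF : (431 : F) = 0) (hω : ω ^ 2 + ω + 1 = 0) (r s : ℤ) :
    ((r : F) + s * ω) ^ 431 = r + s * ω ^ 2 := by
  have hp : Nat.Prime 431 := by norm_num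
  have : Fact (Nat.Prime 431) := ⟨hp⟩
  have : CharP F 431 := (CharP.charP_iff_prime_eq_zero hp).2 (by exact_mod_cast hF)
  have hint (n : ℤ) : (n : F) ^ 431 = n := by
    have := congrArg (ZMod.castHom dvd_rfl F) (ZMod.pow_card (n : ZMod 431))
    rwa [map_pow, map_intCast] at this
  have hω3 : ω ^ 3 = 1 := by linear_combination (ω - 1) * hω
  rw [add_pow_char, mul_pow, hint, hint, show 431 = 3 * 143 + 2 from rfl, pow_add ω, pow_mul ω,
    hω3, one_pow, one_mul]

theorem pow_eq_one_of_ne_zero (hF : (431 : F) = 0) (hω : ω ^ 2 + ω + 1 = 0) {r s : ℤ}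
    (h : (r : F) + s * ω ≠ 0) : ((r : F) + s * ω) ^ (9 * 20640) = 1 := by
  have hconj : (r : F) + s * ω ^ 2 = (r - s : ℤ) + (-s : ℤ) * ω := by
    push_cast
    linear_combination s * hω
  have h2 : (((r : F) + s * ω) ^ 431) ^ 431 = r + s * ω := by
    rw [frobenius_apply hF hω, hconj, frobenius_apply hF hω]
    push_cast
    linear_combination -s * hω
  refine mul_right_cancel₀ h ?_
  rw [one_mul, ← pow_succ]
  rwa [← pow_mul] at h2

theorem pow_eq_of_frobenius (hF : (431 : F) = 0) (hω : ω ^ 2 + ω + 1 = 0) {r s : ℤ} {ρ : F}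
    (h : (r : F) + s * ω ≠ 0) (hρ : (r : F) + s * ω ^ 2 = ρ * (r + s * ω)) :
    ((r : F) + s * ω) ^ 20640 = ρ ^ 48 := by
  rw [show 20640 = 430 * 48 from rfl, pow_mul]
  congr 1
  refine mul_right_cancel₀ h ?_
  rw [← pow_succ, frobenius_apply hF hω, hρ]

theorem intCast_ne_zero (hF : (431 : F) = 0) {n : ℤ} (hn : ¬ (431 : ℤ) ∣ n) : (n : F) ≠ 0 := by
  have hp : Nat.Prime 431 := by norm_num
  have : CharP F 431 := (CharP.charP_iff_prime_eq_zero hp).2 (by exact_mod_cast hF)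
  rw [Ne, CharP.intCast_eq_zero_iff F 431]
  exact_mod_cast hn

theorem one_sub_ne_zero (hF : (431 : F) = 0) (hω : ω ^ 2 + ω + 1 = 0) : 1 - ω ≠ 0 := by
  intro h
  refine one_ne_zero (α := F) ?_
  linear_combination 144 * hω + 144 * (ω + 2) * h - hF

theorem intCast_pow (hF : (431 : F) = 0) (hω : ω ^ 2 + ω + 1 = 0) {n : ℤ}
    (hn : ¬ (431 : ℤ) ∣ n) : (n : F) ^ 20640 = 1 := by
  have h := pow_eq_of_frobenius hF hω (r := n) (s := 0) (ρ := 1)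
    (by simpa using intCast_ne_zero hF hn) (by simp)
  simpa using h

theorem one_sub_pow (hF : (431 : F) = 0) (hω : ω ^ 2 + ω + 1 = 0) : (1 - ω) ^ 20640 = 1 := by
  have h := pow_eq_of_frobenius hF hω (r := 1) (s := -1) (ρ := 1 + ω)
    (by simpa [← sub_eq_add_neg] using one_sub_ne_zero hF hω) (by push_cast; ring)
  have hω3 : ω ^ 3 = 1 := by linear_combination (ω - 1) * hω
  have h1 : 1 + ω = -ω ^ 2 := by linear_combination hω
  rw [h1, Even.neg_pow (by decide), ← pow_mul, show 2 * 48 = 3 * 32 from rfl, pow_mul, hω3,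
    one_pow] at h
  simpa [← sub_eq_add_neg] using h

theorem fundamentalUnit_pow (hF : (431 : F) = 0) (hω : ω ^ 2 + ω + 1 = 0) :
    (55 * ω ^ 2 - 2) ^ 20640 = ω := by
  have h55 : 55 * ω ^ 2 - 2 = (-57 : ℤ) + (-55 : ℤ) * ω := by
    push_cast
    linear_combination 55 * hω
  set ρ := 219 + 415 * ω with hρ
  have hρ2 : ρ ^ 2 = 295 + 63 * ω := by
    rw [hρ]
    linear_combination 172225 * hω + (-289 + 22 * ω) * hF
  have hρ3 : ρ ^ 3 = 101 + 172 * ω := by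
    rw [pow_succ, hρ2, hρ]
    linear_combination 26145 * hω + (89 + 255 * ω) * hF
  have hρ12 : ρ ^ 12 = -ω := by
    rw [show 12 = 3 * 2 * 2 from rfl, pow_mul, pow_mul, hρ3,
      show (101 + 172 * ω) ^ 2 = 12 + -12 * ω by
        linear_combination 29584 * hω + (-45 + 12 * ω) * hF]
    linear_combination 144 * hω - ω * hF
  have hne : 55 * ω ^ 2 - 2 ≠ 0 := by
    intro h
    refine intCast_ne_zero hF (n := 122) (by norm_num) ?_
    push_cast
    linear_combination (55 * ω - 2) * h + (110 - 3025 * (ω - 1)) * hω - 7 * hF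
  rw [h55] at hne ⊢
  rw [pow_eq_of_frobenius hF hω (ρ := ρ) hne, show 48 = 12 * 4 from rfl, pow_mul, hρ12]
  · linear_combination (ω ^ 2 - ω) * hω
  · rw [hρ]
    push_cast
    linear_combination 22770 * hω + (-24 + 30 * ω) * hF

end FieldOfOrder

theorem not_dvd_and_isCoprime_of_eq {x y z : ℤ} (hgcd : Int.gcd x (Int.gcd y z) = 1)
    (he : x ^ 3 + 9 * y ^ 3 = 431 ^ 2 * z ^ 9) (hn : ¬ ((431 : ℤ) ∣ x ∧ (431 : ℤ) ∣ y)) :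
    ¬ (431 : ℤ) ∣ y ∧ ¬ (3 : ℤ) ∣ x ∧ IsCoprime x y := by
  have h431 : Prime (431 : ℤ) := Nat.prime_iff_prime_int.1 (by norm_num)
  have hprim (q : ℤ) (hq : Prime q) (hx : q ∣ x) (hy : q ∣ y) (hz : q ∣ z) : False := by
    have := Int.dvd_coe_gcd hx (Int.dvd_coe_gcd hy hz)
    rw [hgcd] at this
    exact hq.not_isUnit (isUnit_of_dvd_one (by exact_mod_cast this))
  have hy : ¬ (431 : ℤ) ∣ y := fun hy => hn ⟨h431.dvd_of_dvd_pow (n := 3) (by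
    rw [show x ^ 3 = 431 ^ 2 * z ^ 9 - 9 * y ^ 3 by linear_combination he]
    exact dvd_sub (Dvd.intro _ (by ring : (431 : ℤ) * (431 * z ^ 9) = _))
      ((dvd_pow hy three_ne_zero).mul_left _)), hy⟩
  refine ⟨hy, fun hx => ?_, isCoprime_of_prime_dvd ?_ fun q hq hqx hqy => ?_⟩
  · have hz : (3 : ℤ) ∣ z := by
      have : (3 : ℤ) ∣ 431 ^ 2 * z ^ 9 := he ▸ dvd_add (dvd_pow hx three_ne_zero)
        (Dvd.intro _ (by ring : (3 : ℤ) * (3 * y ^ 3) = _))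
      rcases Int.prime_three.dvd_or_dvd this with h | h
      · norm_num at h
      · exact Int.prime_three.dvd_of_dvd_pow h
    obtain ⟨a, rfl⟩ := id hx
    obtain ⟨b, rfl⟩ := id hz
    refine hprim 3 Int.prime_three hx (Int.prime_three.dvd_of_dvd_pow (n := 3) ?_) hz
    exact ⟨431 ^ 2 * 3 ^ 6 * b ^ 9 - a ^ 3, by linarith⟩
  · rintro ⟨rfl, rfl⟩
    simp at hy
  · have : q ∣ 431 ^ 2 * z ^ 9 := he ▸ dvd_add (dvd_pow hqx three_ne_zero)
      ((dvd_pow hqy three_ne_zero).mul_left _)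
    rcases hq.dvd_or_dvd this with h | h
    · exact hy (((hq.associated_of_dvd h431 (hq.dvd_of_dvd_pow h)).symm.dvd).trans hqy)
    · exact hprim q hq hqx hqy (hq.dvd_of_dvd_pow h)

theorem dvd_add_of_pow_three_eq {x y z : ℤ} (he : x ^ 3 + 9 * y ^ 3 = 431 ^ 2 * z ^ 9) :
    (431 : ℤ) ∣ x + 55 * y := by
  have : Fact (Nat.Prime 431) := ⟨by norm_num⟩
  have h0 : (431 : ZMod 431) = 0 := rfl
  have hc : (x : ZMod 431) ^ 3 = (-55 * y) ^ 3 := by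
    have := congrArg (Int.cast : ℤ → ZMod 431) he
    push_cast at this
    linear_combination this + (431 * (z : ZMod 431) ^ 9 + 386 * (y : ZMod 431) ^ 3) * h0
  have hx : (x : ZMod 431) = -55 * y := by
    rw [← ZMod.pow_card (x : ZMod 431), ← ZMod.pow_card (-55 * (y : ZMod 431))]
    rcases eq_or_ne (x : ZMod 431) 0 with h | h
    · rw [h, zero_pow three_ne_zero] at hc
      rw [h, pow_eq_zero_iff three_ne_zero |>.1 hc.symm]
    · have h' : -55 * (y : ZMod 431) ≠ 0 := fun h' => by simp [h', h] at hc
      have := congrArg (· ^ 287) hc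
      simp only [← pow_mul] at this
      rw [show 3 * 287 = 431 + 430 from rfl, pow_add, pow_add, ZMod.pow_card_sub_one_eq_one h,
        ZMod.pow_card_sub_one_eq_one h'] at this
      simpa using this
  have h1 : ((x + 55 * y : ℤ) : ZMod 431) = 0 := by
    push_cast
    rw [hx]
    ring
  exact_mod_cast (ZMod.intCast_zmod_eq_zero_iff_dvd _ 431).1 h1

theorem exists_field_hom_of_prime.{u} {R : Type u} [CommRing R] [IsDomain R]
    [IsPrincipalIdealRing R] {q : R} (hq : Prime q) :
    ∃ (F : Type u) (_ : Field F) (φ : R →+* F), ∀ a, φ a = 0 ↔ q ∣ a := by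
  have := PrincipalIdealRing.isMaximal_of_irreducible hq.irreducible
  exact ⟨R ⧸ Ideal.span {q}, Ideal.Quotient.field _, Ideal.Quotient.mk _, fun a => by
    rw [Ideal.Quotient.eq_zero_iff_mem, Ideal.mem_span_singleton]⟩

/-- `θ` is a cube root of `3` and `1, θ, θ²` is a `ℤ`-basis of `R`. -/
structure IsIntegralGenerator {R : Type*} [CommRing R] (θ : R) : Prop where
  pow_three : θ ^ 3 = 3
  exists_coords : ∀ z : R, ∃ a b c : ℤ, z = a + b * θ + c * θ ^ 2
  coords_eq_zero : ∀ {a b c : ℤ}, (a : R) + b * θ + c * θ ^ 2 = 0 → a = 0 ∧ b = 0 ∧ c = 0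

namespace IsIntegralGenerator

section Coordinates

variable {R : Type*} [CommRing R] {θ : R}

theorem coords_inj (h : IsIntegralGenerator θ) {a b c a' b' c' : ℤ}
    (he : (a : R) + b * θ + c * θ ^ 2 = a' + b' * θ + c' * θ ^ 2) :
    a = a' ∧ b = b' ∧ c = c' := by
  have := h.coords_eq_zero (a := a - a') (b := b - b') (c := c - c') (by
    push_cast
    linear_combination he)
  omega

theorem coords_mul (h : IsIntegralGenerator θ) (a b c d e f : ℤ) :
    ((a : R) + b * θ + c * θ ^ 2) * (d + e * θ + f * θ ^ 2) =
      (a * d + 3 * (b * f + c * e) : ℤ) + (a * e + b * d + 3 * (c * f) : ℤ) * θ +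
        (a * f + b * e + c * d : ℤ) * θ ^ 2 := by
  push_cast
  linear_combination (b * f + c * e + c * f * θ : R) * h.pow_three

theorem coords_cube (h : IsIntegralGenerator θ) (a b c : ℤ) :
    ((a : R) + b * θ + c * θ ^ 2) ^ 3 =
      (a ^ 3 + 3 * b ^ 3 + 9 * c ^ 3 + 18 * (a * b * c) : ℤ) +
        (3 * (a ^ 2 * b + 3 * (a * c ^ 2) + 3 * (b ^ 2 * c)) : ℤ) * θ +
        (3 * (a ^ 2 * c + a * b ^ 2 + 3 * (b * c ^ 2)) : ℤ) * θ ^ 2 := by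
  push_cast
  linear_combination (b ^ 3 + c ^ 3 * (θ ^ 3 + 3) + 6 * a * b * c + 3 * a * c ^ 2 * θ
    + 3 * b ^ 2 * c * θ + 3 * b * c ^ 2 * θ ^ 2 : R) * h.pow_three

theorem three_dvd_of_isUnit (h : IsIntegralGenerator θ) {a b c : ℤ}
    (hu : IsUnit ((a : R) + b * θ + c * θ ^ 2)) : 3 ∣ b := by
  obtain ⟨z, hz⟩ := hu.exists_right_inv
  obtain ⟨d, e, f, rfl⟩ := h.exists_coords z
  rw [h.coords_mul] at hz
  obtain ⟨h1, h2, h3⟩ := h.coords_inj (a' := 1) (b' := 0) (c' := 0) (hz.trans (by simp))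
  have hnorm : (a ^ 3 + 3 * b ^ 3 + 9 * c ^ 3 - 9 * (a * b * c)) *
      (d ^ 3 + 3 * e ^ 3 + 9 * f ^ 3 - 9 * (d * e * f)) = 1 := by
    calc _ = (a * d + 3 * (b * f + c * e)) ^ 3 + 3 * (a * e + b * d + 3 * (c * f)) ^ 3 +
          9 * (a * f + b * e + c * d) ^ 3 - 9 * ((a * d + 3 * (b * f + c * e)) *
            (a * e + b * d + 3 * (c * f)) * (a * f + b * e + c * d)) := by ring
      _ = 1 := by rw [h1, h2, h3]; norm_num
  have hmod : ∀ a b : ZMod 9, a ^ 3 + 3 * b ^ 3 = 1 ∨ a ^ 3 + 3 * b ^ 3 = -1 → 3 * b = 0 := by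
    decide
  have h9 : (9 : ZMod 9) = 0 := rfl
  have h3b : ((3 * b : ℤ) : ZMod 9) = 0 := by
    push_cast
    refine hmod a b ((Int.isUnit_iff.1 (IsUnit.of_mul_eq_one _ hnorm)).imp ?_ ?_) <;>
    · intro hn
      have := congrArg (Int.cast : ℤ → ZMod 9) hn
      push_cast [h9] at this
      simpa using this
  rw [ZMod.intCast_zmod_eq_zero_iff_dvd] at h3b
  omega

theorem sq_sub_two_ne_cube (h : IsIntegralGenerator θ) (v : R) : θ ^ 2 - 2 ≠ v ^ 3 := by
  intro hv
  obtain ⟨a, b, c, rfl⟩ := h.exists_coords v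
  rw [h.coords_cube] at hv
  have := (h.coords_inj (a := -2) (b := 0) (c := 1) (Eq.trans (by push_cast; ring) hv)).2.2
  omega

theorem isUnit_sq_sub_two (h : IsIntegralGenerator θ) : IsUnit (θ ^ 2 - 2) :=
  IsUnit.of_mul_eq_one (4 + 3 * θ + 2 * θ ^ 2) (by linear_combination (3 + 2 * θ) * h.pow_three)

theorem cube_coords_of_three_dvd (h : IsIntegralGenerator θ) (a b c : ℤ) :
    ∃ A B C : ℤ, ((a : R) + (3 * b : ℤ) * θ + c * θ ^ 2) ^ 3 =
      A + (9 * B : ℤ) * θ + (3 * C : ℤ) * θ ^ 2 := by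
  refine ⟨a ^ 3 + 3 * (3 * b) ^ 3 + 9 * c ^ 3 + 18 * (a * (3 * b) * c),
    a ^ 2 * b + a * c ^ 2 + 9 * (b ^ 2 * c), a ^ 2 * c + a * (3 * b) ^ 2 + 3 * (3 * b * c ^ 2), ?_⟩
  rw [h.coords_cube]
  push_cast
  ring

theorem three_dvd_of_eq_mul_pow_nine (h : IsIntegralGenerator θ) {x y : ℤ} {v w : R}
    (hv : IsUnit v) (he : (x : R) + y * θ ^ 2 = v ^ 3 * (8 - 3 * θ) ^ 2 * w ^ 9) : 3 ∣ x := by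
  obtain ⟨a, b, c, rfl⟩ := h.exists_coords v
  obtain ⟨b, rfl⟩ := h.three_dvd_of_isUnit hv
  obtain ⟨r, s, t, rfl⟩ := h.exists_coords w
  have h64 : (8 - 3 * θ) ^ 2 = (64 : ℤ) + (-48 : ℤ) * θ + (9 : ℤ) * θ ^ 2 := by
    push_cast
    ring
  obtain ⟨A, B, C, hA⟩ := h.cube_coords_of_three_dvd a b c
  obtain ⟨D, E, G, hD⟩ := h.cube_coords_of_three_dvd
    (r ^ 3 + 3 * s ^ 3 + 9 * t ^ 3 + 18 * (r * s * t))
    (r ^ 2 * s + 3 * (r * t ^ 2) + 3 * (s ^ 2 * t)) (3 * (r ^ 2 * t + r * s ^ 2 + 3 * (s * t ^ 2)))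
  rw [show 9 = 3 * 3 from rfl, pow_mul, h64, h.coords_cube r s t, hA, hD, h.coords_mul,
    h.coords_mul] at he
  obtain ⟨hx, hθ, -⟩ := h.coords_inj (a := x) (b := 0) (c := y) (Eq.trans (by simp) he)
  ring_nf at hx hθ
  omega

end Coordinates

section Reduction

variable {R F : Type*} [CommRing R] [Field F] {θ : R} {φ : R →+* F}

theorem natCast_eq_zero_of_map_eq_zero (h : IsIntegralGenerator θ)
    (hφ : φ (64 + 24 * θ + 9 * θ ^ 2) = 0) : (431 : F) = 0 := by
  have := congrArg φ (show (431 : R) = (8 - 3 * θ) * (64 + 24 * θ + 9 * θ ^ 2) by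
    linear_combination 27 * h.pow_three)
  rwa [map_mul, hφ, mul_zero, map_ofNat] at this

theorem isPrimitiveCubeRoot_of_map_eq_zero (h : IsIntegralGenerator θ)
    (hφ : φ (64 + 24 * θ + 9 * θ ^ 2) = 0) : (162 * φ θ) ^ 2 + 162 * φ θ + 1 = 0 := by
  have hF := h.natCast_eq_zero_of_map_eq_zero hφ
  simp only [map_add, map_mul, map_pow, map_ofNat] at hφ
  linear_combination 330 * hφ + (54 * φ θ ^ 2 - 18 * φ θ - 49) * hF

theorem map_add_mul_sq (h : IsIntegralGenerator θ) (hφ : φ (64 + 24 * θ + 9 * θ ^ 2) = 0)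
    {x y : ℤ} (hxy : (431 : ℤ) ∣ x + 55 * y) :
    φ (x + y * θ ^ 2) = ((55 * y : ℤ) : F) * (1 - 162 * φ θ) * (162 * φ θ) ^ 2 := by
  have hF := h.natCast_eq_zero_of_map_eq_zero hφ
  have hω := h.isPrimitiveCubeRoot_of_map_eq_zero hφ
  obtain ⟨k, hk⟩ := hxy
  obtain rfl : x = 431 * k - 55 * y := by omega
  simp only [map_add, map_mul, map_pow, map_intCast]
  push_cast
  linear_combination (k - 3349 * y * φ θ ^ 2) * hF +
    (55 * y * (162 * φ θ - 1)) * hω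

theorem map_add_mul_sq_ne_zero (h : IsIntegralGenerator θ)
    (hφ : φ (64 + 24 * θ + 9 * θ ^ 2) = 0) {x y : ℤ} (hy : ¬ (431 : ℤ) ∣ y)
    (hxy : (431 : ℤ) ∣ x + 55 * y) : φ (x + y * θ ^ 2) ≠ 0 := by
  have hF := h.natCast_eq_zero_of_map_eq_zero hφ
  have hω := h.isPrimitiveCubeRoot_of_map_eq_zero hφ
  rw [h.map_add_mul_sq hφ hxy]
  refine mul_ne_zero (mul_ne_zero (intCast_ne_zero hF (by omega)) (one_sub_ne_zero hF hω))
    (pow_ne_zero _ fun h0 => ?_)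
  simp [h0] at hω

theorem three_dvd_of_eq_pow_mul (h : IsIntegralGenerator θ)
    (hφ : φ (64 + 24 * θ + 9 * θ ^ 2) = 0) {x y : ℤ} (hy : ¬ (431 : ℤ) ∣ y)
    (hxy : (431 : ℤ) ∣ x + 55 * y) {n : ℕ} {t : R}
    (he : x + y * θ ^ 2 = (θ ^ 2 - 2) ^ n * (8 - 3 * θ) ^ 2 * t ^ 9) : 3 ∣ n := by
  have hF := h.natCast_eq_zero_of_map_eq_zero hφ
  have hω := h.isPrimitiveCubeRoot_of_map_eq_zero hφ
  have hne := h.map_add_mul_sq_ne_zero hφ hy hxy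
  have hA := h.map_add_mul_sq hφ hxy
  obtain ⟨a, b, c, rfl⟩ := h.exists_coords t
  have hε : φ (θ ^ 2 - 2) = 55 * (162 * φ θ) ^ 2 - 2 := by
    simp only [map_sub, map_pow, map_ofNat]
    linear_combination -3349 * φ θ ^ 2 * hF
  have hp : φ (8 - 3 * θ) = (8 : ℤ) * (1 - 162 * φ θ) := by
    simp only [map_sub, map_mul, map_ofNat]
    push_cast
    linear_combination 3 * φ θ * hF
  have ht : φ (a + b * θ + c * θ ^ 2) =
      ((a - 55 * c : ℤ) : F) + ((290 * b - 55 * c : ℤ) : F) * (162 * φ θ) := by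
    simp only [map_add, map_mul, map_pow, map_intCast]
    push_cast
    linear_combination (-109 * b * φ θ - 3349 * c * φ θ ^ 2) * hF + 55 * c * hω
  have ht0 : φ (a + b * θ + c * θ ^ 2) ≠ 0 := by
    intro h0
    rw [he, map_mul, map_pow _ _ 9, h0] at hne
    simp at hne
  have hω3 : (162 * φ θ) ^ 3 = 1 := by linear_combination (162 * φ θ - 1) * hω
  have hωn : (162 * φ θ) ^ n = 1 := by
    have hL : φ (x + y * θ ^ 2) ^ 20640 = 1 := by
      rw [hA, mul_pow, mul_pow, intCast_pow hF hω (by omega), one_sub_pow hF hω, ← pow_mul,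
        show 2 * 20640 = 3 * 13760 from rfl, pow_mul, hω3]
      simp
    have hp1 : φ (8 - 3 * θ) ^ 20640 = 1 := by
      rw [hp, mul_pow, intCast_pow hF hω (by omega), one_sub_pow hF hω, one_mul]
    rw [ht] at ht0
    rw [he, map_mul, map_mul, map_pow, map_pow, map_pow, hε, ht, mul_pow, mul_pow, ← pow_mul _ 9,
      pow_eq_one_of_ne_zero hF hω ht0, pow_right_comm, fundamentalUnit_pow hF hω, pow_right_comm,
      hp1] at hL
    simpa using hL
  have hord : orderOf (162 * φ θ) = 3 := by
    refine orderOf_eq_prime hω3 fun h1 => one_sub_ne_zero hF hω ?_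
    rw [h1, sub_self]
  exact hord ▸ orderOf_dvd_of_pow_eq_one hωn

end Reduction

section Descent

variable {R : Type*} [CommRing R] {θ : R}

theorem mul_eq_prime (h : IsIntegralGenerator θ) :
    (8 - 3 * θ) * (64 + 24 * θ + 9 * θ ^ 2) = 431 := by
  linear_combination -27 * h.pow_three

theorem factor_sum (h : IsIntegralGenerator θ) (x y : R) :
    (x + y * θ ^ 2) * (x ^ 2 - x * y * θ ^ 2 + 3 * y ^ 2 * θ) = x ^ 3 + 9 * y ^ 3 := by
  linear_combination (3 * y ^ 3 - x * y ^ 2 * θ) * h.pow_three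

theorem not_isUnit_factor (h : IsIntegralGenerator θ) : ¬ IsUnit (64 + 24 * θ + 9 * θ ^ 2) := by
  intro hu
  obtain ⟨u, hu⟩ := hu.exists_right_inv
  obtain ⟨a, b, c, rfl⟩ := h.exists_coords u
  have := (h.coords_inj (a := 8) (b := -3) (c := 0) (a' := 431 * a) (b' := 431 * b)
    (c' := 431 * c) (by
      push_cast
      linear_combination -(8 - 3 * θ) * hu + (a + b * θ + c * θ ^ 2) * h.mul_eq_prime)).1
  omega

theorem dvd_add_mul_sq (h : IsIntegralGenerator θ) {x y : ℤ} (hxy : (431 : ℤ) ∣ x + 55 * y) :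
    8 - 3 * θ ∣ (x : R) + y * θ ^ 2 := by
  obtain ⟨k, hk⟩ := hxy
  obtain rfl : x = 431 * k - 55 * y := by omega
  refine ⟨(64 + 24 * θ + 9 * θ ^ 2) * k - y * (8 + 3 * θ + θ ^ 2), ?_⟩
  push_cast
  linear_combination (27 * k - 3 * y) * h.pow_three

theorem isCoprime_factors (h : IsIntegralGenerator θ) {x y : ℤ} (hx : ¬ (3 : ℤ) ∣ x)
    (hxy : IsCoprime x y) :
    IsCoprime ((x : R) + y * θ ^ 2) (x ^ 2 - x * y * θ ^ 2 + 3 * y ^ 2 * θ) := by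
  have h3 : IsCoprime (3 : ℤ) x := (Int.prime_three.coprime_iff_not_dvd).2 hx
  have h1 : IsCoprime x (x ^ 3 + 9 * y ^ 3) := by
    have : IsCoprime x (9 * y ^ 3) := IsCoprime.mul_right
      (by simpa using (h3.symm.pow_right (n := 2))) hxy.pow_right
    simpa [pow_succ, add_comm] using this.add_mul_left_right (x ^ 2)
  have h2 : IsCoprime 3 (x ^ 3 + 9 * y ^ 3) := by
    have : IsCoprime 3 (x ^ 3) := h3.pow_right
    rwa [show x ^ 3 + 9 * y ^ 3 = x ^ 3 + 3 * (3 * y ^ 3) by ring, IsCoprime.add_mul_left_right_iff]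
  have hN := ((h2.mul_left (h1.pow_left (m := 2))).map (Int.castRingHom R))
  simp only [eq_intCast] at hN
  push_cast at hN
  rw [← h.factor_sum] at hN
  convert (hN.of_mul_right_left).symm.add_mul_left_right (y * θ ^ 2 - 2 * x) using 1
  linear_combination (-y ^ 2 * θ) * h.pow_three

variable [IsDomain R] [IsPrincipalIdealRing R]

theorem isCoprime_add_mul_sq (h : IsIntegralGenerator θ) {x y : ℤ} (hy : ¬ (431 : ℤ) ∣ y)
    (hxy : (431 : ℤ) ∣ x + 55 * y) :
    IsCoprime ((x : R) + y * θ ^ 2) (64 + 24 * θ + 9 * θ ^ 2) := by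
  refine isCoprime_of_prime_dvd ?_ fun q hq hqA hqp => ?_
  · rintro ⟨-, h0⟩
    have := (h.coords_eq_zero (a := 64) (b := 24) (c := 9) (by exact_mod_cast h0)).1
    omega
  · obtain ⟨F, _, φ, hφ⟩ := exists_field_hom_of_prime hq
    exact h.map_add_mul_sq_ne_zero ((hφ _).2 hqp) hy hxy ((hφ _).2 hqA)

theorem exists_eq_mul_pow_nine (h : IsIntegralGenerator θ) {x y z : ℤ}
    (hy : ¬ (431 : ℤ) ∣ y) (hx : ¬ (3 : ℤ) ∣ x) (hxy : IsCoprime x y)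
    (he : x ^ 3 + 9 * y ^ 3 = 431 ^ 2 * z ^ 9) :
    ∃ (u : Rˣ) (w : R), (x : R) + y * θ ^ 2 = u * (8 - 3 * θ) ^ 2 * w ^ 9 := by
  have h431 := dvd_add_of_pow_three_eq he
  have hAB := h.isCoprime_factors hx hxy
  have hp1 := h.dvd_add_mul_sq h431
  have hp2 := h.isCoprime_add_mul_sq hy h431
  have hprod := h.factor_sum x y
  have he' : (x : R) ^ 3 + 9 * y ^ 3 = (8 - 3 * θ) ^ 2 * (64 + 24 * θ + 9 * θ ^ 2) ^ 2 * z ^ 9 := by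
    rw [← mul_pow, h.mul_eq_prime]
    exact_mod_cast congrArg (Int.cast : ℤ → R) he
  rw [he'] at hprod
  have hd1 : (8 - 3 * θ) ^ 2 ∣ (x : R) + y * θ ^ 2 :=
    ((hAB.of_isCoprime_of_dvd_left hp1).pow_left).dvd_of_dvd_mul_right
      (hprod ▸ (Dvd.intro _ rfl).mul_right _)
  have hd2 : (64 + 24 * θ + 9 * θ ^ 2) ^ 2 ∣ (x : R) ^ 2 - x * y * θ ^ 2 + 3 * y ^ 2 * θ :=
    (hp2.symm.pow_left).dvd_of_dvd_mul_left (hprod ▸ (Dvd.intro_left _ rfl).mul_right _)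
  obtain ⟨a, ha⟩ := hd1
  obtain ⟨b, hb⟩ := hd2
  rw [ha, hb] at hprod hAB
  have h0 : (8 - 3 * θ) ^ 2 * (64 + 24 * θ + 9 * θ ^ 2) ^ 2 ≠ 0 := by
    rw [← mul_pow, h.mul_eq_prime]
    refine pow_ne_zero _ fun h0 => ?_
    have := (h.coords_eq_zero (a := 431) (b := 0) (c := 0) (by simpa using h0)).1
    omega
  have hab : a * b = z ^ 9 := mul_left_cancel₀ h0 (by linear_combination hprod)
  obtain ⟨w, u, hw⟩ := exists_associated_pow_of_mul_eq_pow'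
    (hAB.of_mul_left_right.of_mul_right_right) hab
  exact ⟨u, w, by rw [ha, ← hw]; ring⟩

theorem dvd_and_dvd_of_eq (h : IsIntegralGenerator θ)
    (hunits : ∀ u : Rˣ, ∃ i < 3, ∃ v : Rˣ, (u : R) = (θ ^ 2 - 2) ^ i * v ^ 3) {x y z : ℤ}
    (hgcd : Int.gcd x (Int.gcd y z) = 1) (he : x ^ 3 + 9 * y ^ 3 = 431 ^ 2 * z ^ 9) :
    (431 : ℤ) ∣ x ∧ (431 : ℤ) ∣ y := by
  by_contra hn
  obtain ⟨hy, hx, hxy⟩ := not_dvd_and_isCoprime_of_eq hgcd he hn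
  obtain ⟨u, w, hA⟩ := h.exists_eq_mul_pow_nine (R := R) hy hx hxy he
  obtain ⟨i, hi, v, hu⟩ := hunits u
  obtain ⟨j, -, s, hv⟩ := hunits v
  obtain ⟨q, hq, hqp⟩ := WfDvdMonoid.exists_irreducible_factor h.not_isUnit_factor fun h0 => by
    have := (h.coords_eq_zero (a := 64) (b := 24) (c := 9) (by exact_mod_cast h0)).1
    omega
  obtain ⟨F, _, φ, hφ⟩ := exists_field_hom_of_prime hq.prime
  have hdvd := h.three_dvd_of_eq_pow_mul ((hφ _).2 hqp) hy (dvd_add_of_pow_three_eq he)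
    (n := i + j * 3) (t := s * w) (by rw [hA, hu, hv]; ring)
  obtain rfl : i = 0 := by omega
  exact hx (h.three_dvd_of_eq_mul_pow_nine (w := w) v.isUnit (by rw [hA, hu]; ring))

end Descent

end IsIntegralGenerator

section NumberField

open NumberField

theorem isIntegralGenerator {K : Type*} [Field K] [NumberField K] {ϑ : 𝓞 K}
    (hK : Module.finrank ℚ K = 3) (hϑ : ϑ ^ 3 = 3) : IsIntegralGenerator ϑ where
  pow_three := hϑ
  exists_coords := exists_coords hK hϑ
  coords_eq_zero := coords_eq_zero hK hϑ

end NumberField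

end PureCubicThree

/-- Every primitive integer solution of `x³ + 9y³ = 431² z⁹` satisfies
`x ≡ y ≡ 0 (mod 431)`. -/
theorem fermat_descent_deg9 :
    ∀ x y z : ℤ, Int.gcd x (Int.gcd y z) = 1 →
      x ^ 3 + 9 * y ^ 3 = 431 ^ 2 * z ^ 9 →
      (431 : ℤ) ∣ x ∧ (431 : ℤ) ∣ y := by
  intro x y z hgcd he
  obtain ⟨K, _, _, ϑ, hK, hϑ⟩ := PureCubicThree.exists_numberField
  have h := PureCubicThree.isIntegralGenerator hK hϑ
  have := PureCubicThree.isPrincipalIdealRing hK hϑ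
  obtain ⟨ε, hε⟩ := h.isUnit_sq_sub_two
  refine h.dvd_and_dvd_of_eq (fun u => ?_) hgcd he
  obtain ⟨i, hi, v, rfl⟩ := PureCubicThree.exists_unit_eq_pow_mul_cube (hK ▸ by decide)
    (PureCubicThree.units_rank_eq_one hK hϑ) (ε := ε)
    (fun v hv => h.sq_sub_two_ne_cube v (by rw [← hε, hv, Units.val_pow_eq_pow_val])) u
  exact ⟨i, hi, v, by push_cast; rw [hε]⟩
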